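/- arXiv:0803.1336 — 2 statements merged into one kernel-verified Lean document; each statement's English description precedes it below -/
import Mathlib

section
/- Each element J_{O,ψ} := Σ_{χ ∈ O} v_χ u_ψ (where O is an H-orbit of characters of N with common stabilizer H_O and ψ is a character of H_O) is a primitive central idempotent of ℂ[G]; moreover, every primitive central idempotent of ℂ[G] is equal to J_{O,ψ} for some such pair (O, ψ), so the J_{O,ψ} form a ℂ-basis of the center Z(ℂ[G]). -/
open SemidirectProduct

/-- The action of `H` on characters of `N`: `(h • χ)(n) = χ(φ(h⁻¹) n)`. -/
def charAct {N H : Type*} [Group N] [Group H] (φ : H →* MulAut N)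
    (h : H) (χ : N →* ℂˣ) : N →* ℂˣ :=
  χ.comp (φ h⁻¹).toMonoidHom

lemma charAct_one {N H : Type*} [Group N] [Group H] (φ : H →* MulAut N)
    (χ : N →* ℂˣ) : charAct φ 1 χ = χ := by
  ext n; simp [charAct]

lemma charAct_mul {N H : Type*} [Group N] [Group H] (φ : H →* MulAut N)
    (a b : H) (χ : N →* ℂˣ) :
    charAct φ (a * b) χ = charAct φ a (charAct φ b χ) := by
  ext n; simp [charAct, mul_inv_rev, map_mul]

/-- The stabilizer `H_χ ≤ H` of the character `χ` of `N`. -/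
def charStab {N H : Type*} [Group N] [Group H] (φ : H →* MulAut N)
    (χ : N →* ℂˣ) : Subgroup H where
  carrier := {h : H | charAct φ h χ = χ}
  one_mem' := charAct_one φ χ
  mul_mem' := by
    intro a b ha hb
    have ha' : charAct φ a χ = χ := ha
    have hb' : charAct φ b χ = χ := hb
    show charAct φ (a * b) χ = χ
    rw [charAct_mul, hb', ha']
  inv_mem' := by
    intro a ha
    have ha' : charAct φ a χ = χ := ha
    show charAct φ a⁻¹ χ = χ
    conv_lhs => rw [← ha', ← charAct_mul, inv_mul_cancel, charAct_one]

/-- `v_χ = (1/|N|) Σ_{n ∈ N} χ(n)⁻¹ · (inl n)`. -/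
noncomputable def vChar {N H : Type*} [Group N] [Fintype N] [Group H]
    (φ : H →* MulAut N) (χ : N →* ℂˣ) : MonoidAlgebra ℂ (N ⋊[φ] H) :=
  (Nat.card N : ℂ)⁻¹ • ∑ n : N,
    MonoidAlgebra.single (SemidirectProduct.inl n) ((((χ n)⁻¹ : ℂˣ) : ℂ))

/-- `u_ψ = (1/|K|) Σ_{h ∈ K} ψ(h)⁻¹ · (inr h)`, for a character `ψ` of a subgroup `K ≤ H`. -/
noncomputable def uChar {N H : Type*} [Group N] [Group H]
    (φ : H →* MulAut N) (K : Subgroup H) (ψ : K →* ℂˣ) : MonoidAlgebra ℂ (N ⋊[φ] H) :=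
  (Nat.card K : ℂ)⁻¹ • ∑ᶠ h : K,
    MonoidAlgebra.single (SemidirectProduct.inr (h : H)) ((((ψ h)⁻¹ : ℂˣ) : ℂ))

open scoped Classical in
/-- `J_{O,ψ} = Σ_{χ' ∈ O} v_{χ'} u_ψ`, where `O` is the `H`-orbit of `χ`. -/
noncomputable def Jorb {N H : Type*} [Group N] [Fintype N] [Group H] [Fintype H]
    (φ : H →* MulAut N) (χ : N →* ℂˣ) (ψ : (charStab φ χ) →* ℂˣ) :
    MonoidAlgebra ℂ (N ⋊[φ] H) :=
  ∑ χ' ∈ Finset.image (fun h : H => charAct φ h χ) Finset.univ,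
    vChar φ χ' * uChar φ (charStab φ χ) ψ

/-- A central idempotent of a ring. -/
def IsCentralIdempotent {A : Type*} [Ring A] (J : A) : Prop :=
  J ∈ Set.center A ∧ J * J = J

/-- A primitive central idempotent: a nonzero central idempotent that cannot be
written as a sum of two nonzero orthogonal central idempotents. -/
def IsPrimitiveCentralIdempotent {A : Type*} [Ring A] (J : A) : Prop :=
  J ≠ 0 ∧ IsCentralIdempotent J ∧
    ¬ ∃ I₁ I₂ : A, I₁ ≠ 0 ∧ I₂ ≠ 0 ∧ IsCentralIdempotent I₁ ∧ IsCentralIdempotent I₂ ∧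
      I₁ * I₂ = 0 ∧ I₂ * I₁ = 0 ∧ J = I₁ + I₂

section CharacterIdempotents

variable {K A : Type*} [CommGroup K] [Fintype K] [Ring A] [Algebra ℂ A]

/-- The idempotent `(1/|K|) Σ_k ψ(k)⁻¹ f(k)` attached to a character `ψ` of `K` and a
homomorphism `f` from `K` to an algebra. -/
noncomputable def charIdem (f : K →* A) (ψ : K →* ℂˣ) : A :=
  (Nat.card K : ℂ)⁻¹ • ∑ k : K, (((ψ k)⁻¹ : ℂˣ) : ℂ) • f k

lemma map_mul_charIdem (f : K →* A) (ψ : K →* ℂˣ) (k : K) :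
    f k * charIdem f ψ = (ψ k : ℂ) • charIdem f ψ := by
  unfold charIdem
  rw [mul_smul_comm, smul_comm]
  congr 1
  rw [Finset.mul_sum, Finset.smul_sum]
  refine Fintype.sum_equiv (Equiv.mulLeft k) _ _ fun x => ?_
  simp only [Equiv.coe_mulLeft, map_mul, mul_smul_comm, smul_smul]
  congr 1
  simp [mul_comm]

lemma charIdem_mul_map (f : K →* A) (ψ : K →* ℂˣ) (k : K) :
    charIdem f ψ * f k = (ψ k : ℂ) • charIdem f ψ := by
  rw [← map_mul_charIdem]
  unfold charIdem
  rw [smul_mul_assoc, mul_smul_comm, Finset.mul_sum, Finset.sum_mul]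
  congr 1
  refine Finset.sum_congr rfl fun x _ => ?_
  rw [smul_mul_assoc, mul_smul_comm, ← map_mul, ← map_mul, mul_comm]

lemma charIdem_mul_self (f : K →* A) (ψ : K →* ℂˣ) :
    charIdem f ψ * charIdem f ψ = charIdem f ψ := by
  conv_lhs => enter [1]; unfold charIdem
  rw [smul_mul_assoc, Finset.sum_mul]
  simp only [smul_mul_assoc, map_mul_charIdem, smul_smul]
  simp [← Nat.cast_smul_eq_nsmul ℂ, smul_smul]

lemma charIdem_mul_of_ne (f : K →* A) {ψ ψ' : K →* ℂˣ} (h : ψ ≠ ψ') :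
    charIdem f ψ * charIdem f ψ' = 0 := by
  obtain ⟨k, hk⟩ := DFunLike.ne_iff.mp h
  have h1 : (ψ k : ℂ) • (charIdem f ψ * charIdem f ψ') =
      (ψ' k : ℂ) • (charIdem f ψ * charIdem f ψ') := by
    rw [← smul_mul_assoc, ← charIdem_mul_map, mul_assoc, map_mul_charIdem, mul_smul_comm]
  rw [← sub_eq_zero, ← sub_smul, smul_eq_zero, sub_eq_zero] at h1
  exact h1.resolve_left fun h2 => hk (Units.ext h2)

lemma sum_monoidHom_apply_inv [Fintype (K →* ℂˣ)] [DecidableEq K] (k : K) :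
    ∑ ψ : K →* ℂˣ, (((ψ k)⁻¹ : ℂˣ) : ℂ) = if k = 1 then (Nat.card K : ℂ) else 0 := by
  split_ifs with h
  · subst h
    simp [← Nat.card_eq_fintype_card,
      CommGroup.card_monoidHom_of_hasEnoughRootsOfUnity K ℂ]
  · obtain ⟨χ, hχ⟩ := CommGroup.exists_apply_ne_one_of_hasEnoughRootsOfUnity K ℂ h
    have h1 : ∑ ψ : K →* ℂˣ, (((ψ k)⁻¹ : ℂˣ) : ℂ) =
        (((χ k)⁻¹ : ℂˣ) : ℂ) * ∑ ψ : K →* ℂˣ, (((ψ k)⁻¹ : ℂˣ) : ℂ) := by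
      rw [Finset.mul_sum]
      refine (Fintype.sum_equiv (Equiv.mulLeft χ) _ _ fun x => ?_).symm
      simp [mul_comm]
    refine (mul_eq_zero.mp (?_ : ((((χ k)⁻¹ : ℂˣ) : ℂ) - 1) * _ = 0)).resolve_left ?_
    · rw [sub_mul, one_mul, ← h1, sub_self]
    · rw [sub_eq_zero, Units.val_eq_one, inv_eq_one]
      exact hχ

lemma sum_charIdem [Fintype (K →* ℂˣ)] (f : K →* A) :
    ∑ ψ : K →* ℂˣ, charIdem f ψ = 1 := by
  classical
  unfold charIdem
  rw [← Finset.smul_sum, Finset.sum_comm]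
  simp only [← Finset.sum_smul, sum_monoidHom_apply_inv]
  simp [ite_smul, smul_smul]

end CharacterIdempotents

section SemidirectProduct

variable {N H : Type*} [CommGroup N] [CommGroup H] (φ : H →* MulAut N)

/-- The embedding of `N` into the group algebra of `N ⋊[φ] H`. -/
noncomputable def inlAlg : N →* MonoidAlgebra ℂ (N ⋊[φ] H) :=
  (MonoidAlgebra.of ℂ (N ⋊[φ] H)).comp SemidirectProduct.inl

/-- The embedding of `H` into the group algebra of `N ⋊[φ] H`. -/
noncomputable def inrAlg : H →* MonoidAlgebra ℂ (N ⋊[φ] H) :=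
  (MonoidAlgebra.of ℂ (N ⋊[φ] H)).comp SemidirectProduct.inr

lemma uChar_eq_charIdem (K : Subgroup H) [Fintype K] (ψ : K →* ℂˣ) :
    uChar φ K ψ = charIdem ((inrAlg φ).comp K.subtype) ψ := by
  simp [uChar, charIdem, inrAlg, MonoidAlgebra.of_apply, MonoidAlgebra.smul_single,
    finsum_eq_sum_of_fintype]

lemma inrAlg_mul_inlAlg (h : H) (n : N) :
    inrAlg φ h * inlAlg φ n = inlAlg φ (φ h n) * inrAlg φ h := by
  simp only [inrAlg, inlAlg, MonoidHom.comp_apply, ← map_mul]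
  congr 1
  ext <;> simp

variable {φ}

lemma single_eq_inlAlg_mul_inrAlg (g : N ⋊[φ] H) (c : ℂ) :
    MonoidAlgebra.single g c = c • (inlAlg φ g.left * inrAlg φ g.right) := by
  simp only [inrAlg, inlAlg, MonoidHom.comp_apply, ← map_mul,
    SemidirectProduct.inl_left_mul_inr_right]
  simp [MonoidAlgebra.of_apply, MonoidAlgebra.smul_single]

lemma charAct_charAct_of_mem_charStab {χ : N →* ℂˣ} {k : H} (hk : k ∈ charStab φ χ) (h : H) :
    charAct φ k (charAct φ h χ) = charAct φ h χ := by
  rw [← charAct_mul, mul_comm, charAct_mul]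
  exact congrArg _ hk

section

variable [Fintype H]

lemma sum_charAct_eq_card_smul {M : Type*} [AddCommGroup M] [Module ℂ M] [DecidableEq (N →* ℂˣ)]
    (χ : N →* ℂˣ) (F : (N →* ℂˣ) → M) :
    ∑ h : H, F (charAct φ h χ) = (Nat.card (charStab φ χ) : ℂ) •
      ∑ χ' ∈ Finset.image (fun h : H => charAct φ h χ) Finset.univ, F χ' := by
  classical
  rw [Finset.sum_comp, Finset.smul_sum]
  refine Finset.sum_congr rfl fun χ' hχ' => ?_
  obtain ⟨g, -, rfl⟩ := Finset.mem_image.mp hχ'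
  rw [Nat.cast_smul_eq_nsmul]
  congr 1
  rw [Nat.card_eq_fintype_card, Fintype.card_subtype]
  refine Finset.card_equiv (Equiv.mulLeft g⁻¹) fun h => ?_
  simp only [Finset.mem_filter_univ, Equiv.coe_mulLeft]
  constructor
  · intro hh
    change charAct φ _ χ = χ
    rw [charAct_mul, hh, ← charAct_mul, inv_mul_cancel, charAct_one]
  · intro hh
    have h1 : charAct φ (g⁻¹ * h) χ = χ := hh
    rw [← congrArg (charAct φ g) h1, ← charAct_mul, mul_inv_cancel_left]

lemma inrAlg_mul_uChar_comm (K : Subgroup H) (ψ : K →* ℂˣ) (h : H) :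
    inrAlg φ h * uChar φ K ψ = uChar φ K ψ * inrAlg φ h := by
  classical
  simp only [uChar_eq_charIdem, charIdem, mul_smul_comm, smul_mul_assoc, Finset.mul_sum,
    Finset.sum_mul]
  congr 1
  refine Finset.sum_congr rfl fun k _ => ?_
  simp [← map_mul, mul_comm h]

lemma inrAlg_mul_uChar (K : Subgroup H) (ψ : K →* ℂˣ) (k : K) :
    inrAlg φ k * uChar φ K ψ = (ψ k : ℂ) • uChar φ K ψ := by
  classical
  rw [uChar_eq_charIdem]
  exact map_mul_charIdem ((inrAlg φ).comp K.subtype) ψ k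

lemma uChar_mul_self (K : Subgroup H) (ψ : K →* ℂˣ) :
    uChar φ K ψ * uChar φ K ψ = uChar φ K ψ := by
  classical
  rw [uChar_eq_charIdem, charIdem_mul_self]

end

variable (φ) [Fintype N]

lemma vChar_eq_charIdem (χ : N →* ℂˣ) : vChar φ χ = charIdem (inlAlg φ) χ := by
  simp [vChar, charIdem, inlAlg, MonoidAlgebra.of_apply, MonoidAlgebra.smul_single]

lemma inrAlg_mul_vChar (h : H) (χ : N →* ℂˣ) :
    inrAlg φ h * vChar φ χ = vChar φ (charAct φ h χ) * inrAlg φ h := by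
  simp only [vChar_eq_charIdem, charIdem, mul_smul_comm, smul_mul_assoc, Finset.mul_sum,
    Finset.sum_mul]
  congr 1
  refine Fintype.sum_equiv (φ h).toEquiv _ _ fun n => ?_
  simp [inrAlg_mul_inlAlg, charAct]

variable [Fintype H]

variable {φ}

lemma vChar_mul_uChar_comm (χ : N →* ℂˣ) (ψ : charStab φ χ →* ℂˣ) (h : H) :
    uChar φ (charStab φ χ) ψ * vChar φ (charAct φ h χ) =
      vChar φ (charAct φ h χ) * uChar φ (charStab φ χ) ψ := by
  classical
  simp only [uChar_eq_charIdem, charIdem, mul_smul_comm, smul_mul_assoc, Finset.mul_sum,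
    Finset.sum_mul]
  congr 1
  refine Finset.sum_congr rfl fun k _ => ?_
  simp [inrAlg_mul_vChar, charAct_charAct_of_mem_charStab k.2]

lemma Jorb_eq_smul_sum (χ : N →* ℂˣ) (ψ : charStab φ χ →* ℂˣ) :
    Jorb φ χ ψ = (Nat.card (charStab φ χ) : ℂ)⁻¹ •
      ∑ h : H, vChar φ (charAct φ h χ) * uChar φ (charStab φ χ) ψ := by
  classical
  rw [sum_charAct_eq_card_smul χ fun χ' => vChar φ χ' * uChar φ (charStab φ χ) ψ, smul_smul,
    inv_mul_cancel₀ (by exact_mod_cast Nat.card_pos.ne'), one_smul, Jorb]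

lemma Jorb_mem_center (χ : N →* ℂˣ) (ψ : charStab φ χ →* ℂˣ) :
    Jorb φ χ ψ ∈ Set.center (MonoidAlgebra ℂ (N ⋊[φ] H)) := by
  have hl (n : N) : inlAlg φ n * Jorb φ χ ψ = Jorb φ χ ψ * inlAlg φ n := by
    simp only [Jorb_eq_smul_sum, mul_smul_comm, smul_mul_assoc, Finset.mul_sum, Finset.sum_mul]
    congr 1
    refine Finset.sum_congr rfl fun h _ => ?_
    conv_rhs => rw [← vChar_mul_uChar_comm, mul_assoc]
    rw [← mul_assoc, vChar_eq_charIdem, map_mul_charIdem, charIdem_mul_map, mul_smul_comm,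
      smul_mul_assoc, ← vChar_eq_charIdem, vChar_mul_uChar_comm]
  have hr (g : H) : inrAlg φ g * Jorb φ χ ψ = Jorb φ χ ψ * inrAlg φ g := by
    simp only [Jorb_eq_smul_sum, mul_smul_comm, smul_mul_assoc, Finset.mul_sum, Finset.sum_mul]
    congr 1
    refine Fintype.sum_equiv (Equiv.mulLeft g) _ _ fun h => ?_
    rw [← mul_assoc, inrAlg_mul_vChar, mul_assoc, inrAlg_mul_uChar_comm, ← mul_assoc,
      ← charAct_mul]
    rfl
  rw [Semigroup.mem_center_iff]
  intro a
  induction a using MonoidAlgebra.induction_linear with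
  | zero => simp
  | add a b ha hb => rw [add_mul, mul_add, ha, hb]
  | single g c =>
    rw [single_eq_inlAlg_mul_inrAlg, smul_mul_assoc, mul_smul_comm, mul_assoc, hr, ← mul_assoc,
      hl, mul_assoc]

lemma Jorb_mul_self (χ : N →* ℂˣ) (ψ : charStab φ χ →* ℂˣ) :
    Jorb φ χ ψ * Jorb φ χ ψ = Jorb φ χ ψ := by
  classical
  unfold Jorb
  rw [Finset.sum_mul]
  refine Finset.sum_congr rfl fun χ' hχ' => ?_
  obtain ⟨g, -, hg⟩ := Finset.mem_image.mp hχ'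
  rw [Finset.mul_sum, Finset.sum_eq_single_of_mem χ' hχ']
  · rw [mul_assoc, ← mul_assoc (uChar _ _ _), ← hg, vChar_mul_uChar_comm, mul_assoc,
      uChar_mul_self, ← mul_assoc, vChar_eq_charIdem, charIdem_mul_self]
  · intro χ'' hχ'' hne
    obtain ⟨g', -, hg'⟩ := Finset.mem_image.mp hχ''
    rw [mul_assoc, ← mul_assoc (uChar _ _ _), ← hg', vChar_mul_uChar_comm, hg', ← mul_assoc,
      ← mul_assoc, vChar_eq_charIdem, vChar_eq_charIdem, charIdem_mul_of_ne _ hne.symm, zero_mul,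
      zero_mul]

lemma coeff_vChar_mul_uChar_one (χ : N →* ℂˣ) (K : Subgroup H) (ψ : K →* ℂˣ) :
    (vChar φ χ * uChar φ K ψ).coeff 1 = (Nat.card N : ℂ)⁻¹ * (Nat.card K : ℂ)⁻¹ := by
  classical
  have h1 (n : N) (k : K) : (inl n * inr (k : H) : N ⋊[φ] H) = 1 ↔ n = 1 ∧ k = 1 := by
    simp [SemidirectProduct.ext_iff]
  simp only [vChar, uChar, finsum_eq_sum_of_fintype, smul_mul_smul_comm, Finset.sum_mul_sum,
    MonoidAlgebra.single_mul_single, MonoidAlgebra.coeff_smul, MonoidAlgebra.coeff_sum,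
    MonoidAlgebra.coeff_single, Finsupp.smul_apply, Finsupp.finsetSum_apply,
    Finsupp.single_apply, h1, ite_and]
  simp

lemma Jorb_ne_zero (χ : N →* ℂˣ) (ψ : charStab φ χ →* ℂˣ) : Jorb φ χ ψ ≠ 0 := by
  intro h0
  have h1 := congrArg (fun x : MonoidAlgebra ℂ (N ⋊[φ] H) => x.coeff 1) h0
  simp [Jorb_eq_smul_sum, coeff_vChar_mul_uChar_one] at h1
  exact Nat.card_pos.ne' h1

lemma isCentralIdempotent_Jorb (χ : N →* ℂˣ) (ψ : charStab φ χ →* ℂˣ) :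
    IsCentralIdempotent (Jorb φ χ ψ) :=
  ⟨Jorb_mem_center χ ψ, Jorb_mul_self χ ψ⟩

lemma exists_vChar_mul_mul_eq_smul (χ : N →* ℂˣ) (ψ : charStab φ χ →* ℂˣ)
    (a : MonoidAlgebra ℂ (N ⋊[φ] H)) :
    ∃ c : ℂ, vChar φ χ * a * (vChar φ χ * uChar φ (charStab φ χ) ψ) =
      c • (vChar φ χ * uChar φ (charStab φ χ) ψ) := by
  induction a using MonoidAlgebra.induction_linear with
  | zero => exact ⟨0, by simp⟩
  | add a b ha hb =>
    obtain ⟨c, hc⟩ := ha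
    obtain ⟨d, hd⟩ := hb
    exact ⟨c + d, by rw [mul_add, add_mul, hc, hd, add_smul]⟩
  | single g c =>
    have h1 : vChar φ χ * MonoidAlgebra.single g c * (vChar φ χ * uChar φ (charStab φ χ) ψ) =
        (c * χ g.left) • (vChar φ χ * vChar φ (charAct φ g.right χ) *
          (inrAlg φ g.right * uChar φ (charStab φ χ) ψ)) := by
      rw [single_eq_inlAlg_mul_inrAlg, mul_smul_comm, smul_mul_assoc, ← mul_assoc (vChar φ χ),
        vChar_eq_charIdem, charIdem_mul_map, smul_mul_assoc, smul_mul_assoc, smul_smul,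
        mul_assoc, ← mul_assoc (inrAlg φ _), ← vChar_eq_charIdem, inrAlg_mul_vChar]
      simp only [mul_assoc]
    by_cases hg : charAct φ g.right χ = χ
    · refine ⟨c * χ g.left * ψ ⟨g.right, hg⟩, ?_⟩
      have h2 := inrAlg_mul_uChar (φ := φ) (charStab φ χ) ψ ⟨g.right, hg⟩
      simp only at h2
      rw [h1, hg, h2, vChar_eq_charIdem, charIdem_mul_self, mul_smul_comm, smul_smul]
    · refine ⟨0, ?_⟩
      rw [h1, vChar_eq_charIdem, vChar_eq_charIdem, charIdem_mul_of_ne _ (Ne.symm hg)]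
      simp

lemma exists_center_mul_Jorb_eq_smul {z : MonoidAlgebra ℂ (N ⋊[φ] H)}
    (hz : z ∈ Set.center (MonoidAlgebra ℂ (N ⋊[φ] H))) (χ : N →* ℂˣ) (ψ : charStab φ χ →* ℂˣ) :
    ∃ c : ℂ, z * Jorb φ χ ψ = c • Jorb φ χ ψ := by
  rw [Semigroup.mem_center_iff] at hz
  obtain ⟨c, hc⟩ := exists_vChar_mul_mul_eq_smul χ ψ z
  refine ⟨c, ?_⟩
  have h1 : z * (vChar φ χ * uChar φ (charStab φ χ) ψ) =
      c • (vChar φ χ * uChar φ (charStab φ χ) ψ) := by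
    rw [← hc, hz, mul_assoc, ← mul_assoc (vChar φ χ) (vChar φ χ), vChar_eq_charIdem,
      charIdem_mul_self]
  have h2 (h : H) : vChar φ (charAct φ h χ) * uChar φ (charStab φ χ) ψ =
      inrAlg φ h * (vChar φ χ * uChar φ (charStab φ χ) ψ) * inrAlg φ h⁻¹ := by
    rw [← mul_assoc, inrAlg_mul_vChar, mul_assoc, mul_assoc, ← inrAlg_mul_uChar_comm,
      ← mul_assoc (inrAlg φ h), ← map_mul, mul_inv_cancel, map_one, one_mul]
  rw [Jorb_eq_smul_sum, mul_smul_comm, smul_comm c]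
  congr 1
  rw [Finset.mul_sum, Finset.smul_sum]
  refine Finset.sum_congr rfl fun h _ => ?_
  rw [h2, ← mul_assoc, ← mul_assoc, ← hz, mul_assoc (inrAlg φ h), h1, mul_smul_comm,
    smul_mul_assoc]

lemma one_mem_span_Jorb :
    (1 : MonoidAlgebra ℂ (N ⋊[φ] H)) ∈ Submodule.span ℂ {x : MonoidAlgebra ℂ (N ⋊[φ] H) |
        ∃ (χ : N →* ℂˣ) (ψ : (charStab φ χ) →* ℂˣ), x = Jorb φ χ ψ} := by
  classical
  have := Fintype.ofFinite (N →* ℂˣ)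
  have h1 (χ : N →* ℂˣ) : ∑ h : H, vChar φ (charAct φ h χ) ∈
      Submodule.span ℂ {x : MonoidAlgebra ℂ (N ⋊[φ] H) |
        ∃ (χ : N →* ℂˣ) (ψ : (charStab φ χ) →* ℂˣ), x = Jorb φ χ ψ} := by
    have := Fintype.ofFinite (charStab φ χ →* ℂˣ)
    have h2 : ∑ h : H, vChar φ (charAct φ h χ) =
        (Nat.card (charStab φ χ) : ℂ) • ∑ ψ : charStab φ χ →* ℂˣ, Jorb φ χ ψ := by
      simp only [Jorb_eq_smul_sum, ← Finset.sum_mul, ← Finset.smul_sum, ← Finset.mul_sum,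
        uChar_eq_charIdem, sum_charIdem, mul_one]
      rw [smul_smul, mul_inv_cancel₀ (by exact_mod_cast Nat.card_pos.ne'), one_smul]
    rw [h2]
    exact Submodule.smul_mem _ _ (Submodule.sum_mem _ fun ψ _ =>
      Submodule.subset_span ⟨χ, ψ, rfl⟩)
  have h3 : (1 : MonoidAlgebra ℂ (N ⋊[φ] H)) = (Nat.card H : ℂ)⁻¹ •
      ∑ χ : N →* ℂˣ, ∑ h : H, vChar φ (charAct φ h χ) := by
    have h4 (h : H) : ∑ χ : N →* ℂˣ, vChar φ (charAct φ h χ) = 1 := by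
      rw [← sum_charIdem (inlAlg φ)]
      refine Fintype.sum_equiv ⟨charAct φ h, charAct φ h⁻¹, fun χ => ?_, fun χ => ?_⟩ _ _
        fun χ => ?_
      · rw [← charAct_mul, inv_mul_cancel, charAct_one]
      · rw [← charAct_mul, mul_inv_cancel, charAct_one]
      · rw [vChar_eq_charIdem]; rfl
    rw [Finset.sum_comm]
    simp only [h4]
    simp [← Nat.cast_smul_eq_nsmul ℂ, smul_smul]
  rw [h3]
  exact Submodule.smul_mem _ _ (Submodule.sum_mem _ fun χ _ => h1 χ)

end SemidirectProduct

section PrimitiveIdempotents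

variable {A : Type*} [Ring A]

lemma IsCentralIdempotent.commute {I : A} (hI : IsCentralIdempotent I) (a : A) :
    a * I = I * a :=
  Semigroup.mem_center_iff.mp hI.1 a

lemma IsCentralIdempotent.mul {I J : A} (hI : IsCentralIdempotent I)
    (hJ : IsCentralIdempotent J) : IsCentralIdempotent (I * J) :=
  ⟨Set.mul_mem_center hI.1 hJ.1, by
    rw [mul_assoc, ← mul_assoc J, hI.commute J, mul_assoc I J, hJ.2, ← mul_assoc, hI.2]⟩

lemma IsPrimitiveCentralIdempotent.eq_of_mul_eq {P J : A} (hP : IsPrimitiveCentralIdempotent P)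
    (hJ : IsCentralIdempotent J) (h0 : J ≠ 0) (h : P * J = J) : P = J := by
  by_contra hne
  have h' : J * P = J := by rw [hP.2.1.commute, h]
  refine hP.2.2 ⟨J, P - J, h0, sub_ne_zero.mpr hne, hJ, ⟨?_, ?_⟩, ?_, ?_, by abel⟩
  · exact (Subring.center A).sub_mem hP.2.1.1 hJ.1
  · rw [sub_mul, mul_sub, mul_sub, hP.2.1.2, hJ.2, h, h', sub_self, sub_zero]
  · rw [mul_sub, h', hJ.2, sub_self]
  · rw [sub_mul, h, hJ.2, sub_self]

variable [Algebra ℂ A]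

lemma smul_eq_zero_or_eq_of_mul_self {J : A} (hJ : J * J = J) {c : ℂ}
    (hc : (c • J) * (c • J) = c • J) : c • J = 0 ∨ c • J = J := by
  rw [smul_mul_smul_comm, hJ, ← sub_eq_zero, ← sub_smul, smul_eq_zero] at hc
  rcases hc with hc | hc
  · have h1 : c * (c - 1) = 0 := by linear_combination hc
    rcases mul_eq_zero.mp h1 with h | h
    · left; simp [h]
    · right; simp [sub_eq_zero.mp h]
  · left; simp [hc]

lemma IsCentralIdempotent.mul_eq_zero_or_eq {I J : A} (hI : IsCentralIdempotent I)
    (hJ : IsCentralIdempotent J) (h : ∃ c : ℂ, I * J = c • J) : I * J = 0 ∨ I * J = J := by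
  obtain ⟨c, hc⟩ := h
  have h1 := (hI.mul hJ).2
  rw [hc] at h1 ⊢
  exact smul_eq_zero_or_eq_of_mul_self hJ.2 h1

lemma IsCentralIdempotent.isPrimitive {J : A} (hJ : IsCentralIdempotent J) (h0 : J ≠ 0)
    (h : ∀ z ∈ Set.center A, ∃ c : ℂ, z * J = c • J) : IsPrimitiveCentralIdempotent J := by
  refine ⟨h0, hJ, ?_⟩
  rintro ⟨I₁, I₂, h1, h2, hI₁, hI₂, h12, h21, hsum⟩
  have h3 : I₁ * J = I₁ := by rw [hsum, mul_add, h12, hI₁.2, add_zero]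
  rcases hI₁.mul_eq_zero_or_eq hJ (h I₁ hI₁.1) with h4 | h4
  · exact h1 (h3 ▸ h4)
  · rw [h3] at h4
    exact h2 (by simpa [h4] using hsum)

lemma linearIndependent_of_orthogonal_idempotents {S : Set A} (h0 : ∀ x ∈ S, x ≠ 0)
    (hS : ∀ x ∈ S, x * x = x) (h : ∀ x ∈ S, ∀ y ∈ S, x ≠ y → x * y = 0) :
    LinearIndependent ℂ ((↑) : S → A) := by
  rw [linearIndependent_iff']
  intro s g hg i hi
  have h1 := congrArg ((i : A) * ·) hg
  simp only [Finset.mul_sum, mul_zero, mul_smul_comm] at h1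
  rw [Finset.sum_eq_single_of_mem i hi fun j _ hj => by
    rw [h i i.2 j j.2 fun e => hj (Subtype.ext e.symm), smul_zero], hS i i.2] at h1
  exact (smul_eq_zero.mp h1).resolve_right (h0 i i.2)

end PrimitiveIdempotents

/-- each `J_{O,ψ}` is a primitive central idempotent of `ℂ[N ⋊ H]`, every
primitive central idempotent arises this way, and the `J_{O,ψ}` form a ℂ-basis of the
center. -/
theorem Jorb_primitive_central_idempotents_basis
    (N H : Type*) [CommGroup N] [Fintype N] [CommGroup H] [Fintype H]
    (φ : H →* MulAut N) :
    (∀ (χ : N →* ℂˣ) (ψ : (charStab φ χ) →* ℂˣ),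
      IsPrimitiveCentralIdempotent (Jorb φ χ ψ)) ∧
    (∀ J : MonoidAlgebra ℂ (N ⋊[φ] H), IsPrimitiveCentralIdempotent J →
      ∃ (χ : N →* ℂˣ) (ψ : (charStab φ χ) →* ℂˣ), J = Jorb φ χ ψ) ∧
    LinearIndependent ℂ
      ((↑) : {x : MonoidAlgebra ℂ (N ⋊[φ] H) |
          ∃ (χ : N →* ℂˣ) (ψ : (charStab φ χ) →* ℂˣ), x = Jorb φ χ ψ} →
        MonoidAlgebra ℂ (N ⋊[φ] H)) ∧
    Submodule.span ℂ {x : MonoidAlgebra ℂ (N ⋊[φ] H) |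
        ∃ (χ : N →* ℂˣ) (ψ : (charStab φ χ) →* ℂˣ), x = Jorb φ χ ψ} =
      Subalgebra.toSubmodule (Subalgebra.center ℂ (MonoidAlgebra ℂ (N ⋊[φ] H))) := by
  have hmul (z : MonoidAlgebra ℂ (N ⋊[φ] H)) (hz : z ∈ Set.center _) (χ : N →* ℂˣ)
      (ψ : charStab φ χ →* ℂˣ) := exists_center_mul_Jorb_eq_smul hz χ ψ
  have hprim (χ : N →* ℂˣ) (ψ : charStab φ χ →* ℂˣ) : IsPrimitiveCentralIdempotent (Jorb φ χ ψ) :=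
    (isCentralIdempotent_Jorb χ ψ).isPrimitive (Jorb_ne_zero χ ψ) fun z hz => hmul z hz χ ψ
  refine ⟨hprim, fun P hP => ?_, ?_, le_antisymm ?_ ?_⟩
  · by_contra! hne
    refine hP.1 ?_
    suffices h : ∀ x ∈ Submodule.span ℂ {x : MonoidAlgebra ℂ (N ⋊[φ] H) |
        ∃ (χ : N →* ℂˣ) (ψ : (charStab φ χ) →* ℂˣ), x = Jorb φ χ ψ}, P * x = 0 by
      simpa using h 1 one_mem_span_Jorb
    intro x hx
    induction hx using Submodule.span_induction with
    | mem x hx =>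
      obtain ⟨χ, ψ, rfl⟩ := hx
      exact (hP.2.1.mul_eq_zero_or_eq (isCentralIdempotent_Jorb χ ψ)
        (hmul P hP.2.1.1 χ ψ)).resolve_right fun h =>
          hne χ ψ (hP.eq_of_mul_eq (isCentralIdempotent_Jorb χ ψ) (Jorb_ne_zero χ ψ) h)
    | zero => simp
    | add x y _ _ hx hy => rw [mul_add, hx, hy, add_zero]
    | smul c x _ hx => rw [mul_smul_comm, hx, smul_zero]
  · refine linearIndependent_of_orthogonal_idempotents ?_ ?_ ?_
    · rintro _ ⟨χ, ψ, rfl⟩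
      exact Jorb_ne_zero χ ψ
    · rintro _ ⟨χ, ψ, rfl⟩
      exact Jorb_mul_self χ ψ
    · rintro _ ⟨χ, ψ, rfl⟩ _ ⟨χ', ψ', rfl⟩ hne
      exact ((hprim χ ψ).2.1.mul_eq_zero_or_eq (isCentralIdempotent_Jorb χ' ψ')
        (hmul _ (Jorb_mem_center χ ψ) χ' ψ')).resolve_right fun h =>
          hne ((hprim χ ψ).eq_of_mul_eq (isCentralIdempotent_Jorb χ' ψ') (Jorb_ne_zero χ' ψ') h)
  · rw [Submodule.span_le]
    rintro _ ⟨χ, ψ, rfl⟩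
    exact Jorb_mem_center χ ψ
  · intro z hz
    suffices h : ∀ x ∈ Submodule.span ℂ {x : MonoidAlgebra ℂ (N ⋊[φ] H) |
        ∃ (χ : N →* ℂˣ) (ψ : (charStab φ χ) →* ℂˣ), x = Jorb φ χ ψ},
        z * x ∈ Submodule.span ℂ {x : MonoidAlgebra ℂ (N ⋊[φ] H) |
        ∃ (χ : N →* ℂˣ) (ψ : (charStab φ χ) →* ℂˣ), x = Jorb φ χ ψ} by
      simpa using h 1 one_mem_span_Jorb
    intro x hx
    induction hx using Submodule.span_induction with
    | mem x hx =>
      obtain ⟨χ, ψ, rfl⟩ := hx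
      obtain ⟨c, hc⟩ := hmul z hz χ ψ
      rw [hc]
      exact Submodule.smul_mem _ _ (Submodule.subset_span ⟨χ, ψ, rfl⟩)
    | zero => simp
    | add x y _ _ hx hy => rw [mul_add]; exact Submodule.add_mem _ hx hy
    | smul c x _ hx => rw [mul_smul_comm]; exact Submodule.smul_mem _ _ hx
end

section
/- Let χ be a character of N with stabilizer H_χ and orbit O_χ under the H-action, and let ψ be a character of H_χ. Then the left ideal ℂ[G] * (v_χ u_ψ) of ℂ[G] has ℂ-dimension equal to |O_χ| = [H : H_χ], the index of the stabilizer of χ in H. -/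
open SemidirectProduct

/-- Left translation by `f a` scales the twisted sum `∑ x, (c x)⁻¹ • f x` by `c a`. -/
lemma MonoidAlgebra.single_mul_sum_character {A G : Type*} [Group A] [Fintype A] [Group G]
    (f : A →* G) (c : A →* ℂˣ) (a : A) :
    (MonoidAlgebra.single (f a) 1 : MonoidAlgebra ℂ G) *
        ∑ x : A, MonoidAlgebra.single (f x) ((((c x)⁻¹ : ℂˣ) : ℂ)) =
      (c a : ℂ) • ∑ x : A, MonoidAlgebra.single (f x) ((((c x)⁻¹ : ℂˣ) : ℂ)) := by
  rw [Finset.mul_sum, Finset.smul_sum]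
  refine Fintype.sum_equiv (Equiv.mulLeft a) _ _ fun x => ?_
  simp [MonoidAlgebra.single_mul_single, mul_comm]

section

variable {N H : Type*} [Group N] [Group H] (φ : H →* MulAut N)

lemma single_inl_mul_vChar [Fintype N] (χ : N →* ℂˣ) (n : N) :
    MonoidAlgebra.single (SemidirectProduct.inl n) 1 * vChar φ χ = (χ n : ℂ) • vChar φ χ := by
  rw [vChar, mul_smul_comm, MonoidAlgebra.single_mul_sum_character, smul_comm]

lemma charStab_apply {χ : N →* ℂˣ} {k : H} (hk : k ∈ charStab φ χ) (n : N) :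
    χ (φ k n) = χ n := by
  have h : charAct φ k⁻¹ χ = χ := inv_mem hk
  simpa [charAct] using DFunLike.congr_fun h n

lemma single_inr_mul_vChar [Fintype N] {χ : N →* ℂˣ} {k : H} (hk : k ∈ charStab φ χ) :
    MonoidAlgebra.single (SemidirectProduct.inr k) 1 * vChar φ χ =
      vChar φ χ * MonoidAlgebra.single (SemidirectProduct.inr k) 1 := by
  rw [vChar, mul_smul_comm, smul_mul_assoc, Finset.mul_sum, Finset.sum_mul]
  congr 1
  refine Fintype.sum_equiv (φ k).toEquiv _ _ fun n => ?_
  simp only [MonoidAlgebra.single_mul_single, one_mul, mul_one, MulEquiv.toEquiv_eq_coe,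
    MulEquiv.coe_toEquiv, charStab_apply φ hk, SemidirectProduct.inl_aut]
  simp

lemma single_inr_mul_uChar [Finite H] (K : Subgroup H) (ψ : K →* ℂˣ) (k : K) :
    MonoidAlgebra.single (SemidirectProduct.inr (k : H)) 1 * uChar φ K ψ =
      (ψ k : ℂ) • uChar φ K ψ := by
  cases nonempty_fintype K
  rw [uChar, finsum_eq_sum_of_fintype, mul_smul_comm, smul_comm]
  congr 1
  exact MonoidAlgebra.single_mul_sum_character (SemidirectProduct.inr.comp K.subtype) ψ k

lemma single_inr_mul_vChar_mul_uChar [Fintype N] [Finite H] (χ : N →* ℂˣ) (ψ : charStab φ χ →* ℂˣ)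
    (k : charStab φ χ) :
    MonoidAlgebra.single (SemidirectProduct.inr (k : H)) 1 *
        (vChar φ χ * uChar φ (charStab φ χ) ψ) =
      (ψ k : ℂ) • (vChar φ χ * uChar φ (charStab φ χ) ψ) := by
  rw [← mul_assoc, single_inr_mul_vChar φ k.2, mul_assoc, single_inr_mul_uChar, mul_smul_comm]

/-- The coefficients of `v_χ u_ψ` on the complement `H`: up to the scalar `1/(|N||K|)` they are
those of `ψ⁻¹`, extended by zero outside `K`. -/
lemma coeff_vChar_mul_uChar_inr [Fintype N] [Finite H] (χ : N →* ℂˣ) (K : Subgroup H) (ψ : K →* ℂˣ)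
    [DecidablePred (· ∈ K)] (h : H) :
    (vChar φ χ * uChar φ K ψ).coeff (SemidirectProduct.inr h) =
      (Nat.card N : ℂ)⁻¹ * (Nat.card K : ℂ)⁻¹ *
        if hh : h ∈ K then (((ψ ⟨h, hh⟩)⁻¹ : ℂˣ) : ℂ) else 0 := by
  classical
  cases nonempty_fintype K
  have key (n : N) (k : K) : (SemidirectProduct.inl n * SemidirectProduct.inr (k : H) :
      N ⋊[φ] H) = SemidirectProduct.inr h ↔ n = 1 ∧ (k : H) = h := by
    simp [SemidirectProduct.ext_iff]
  rw [vChar, uChar, finsum_eq_sum_of_fintype, smul_mul_smul_comm, MonoidAlgebra.coeff_smul_apply,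
    smul_eq_mul, Finset.sum_mul_sum]
  congr 1
  simp only [MonoidAlgebra.single_mul_single, MonoidAlgebra.coeff_sum, Finsupp.finsetSum_apply,
    MonoidAlgebra.coeff_single, Finsupp.single_apply, key, ite_and]
  rw [Finset.sum_eq_single 1 (by simp +contextual) (by simp)]
  simp only [if_true]
  split_ifs with hh
  · rw [Finset.sum_eq_single ⟨h, hh⟩ (by simp +contextual [Subtype.ext_iff]) (by simp)]
    simp
  · exact Finset.sum_eq_zero fun k _ => by
      have : (k : H) ≠ h := fun e => hh (e ▸ k.2)
      simp [this]

lemma linearIndependent_single_out_mul_vChar_mul_uChar [Fintype N] [Finite H] (χ : N →* ℂˣ) (K : Subgroup H)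
    (ψ : K →* ℂˣ) :
    LinearIndependent ℂ fun q : H ⧸ K =>
      MonoidAlgebra.single (SemidirectProduct.inr q.out) 1 * (vChar φ χ * uChar φ K ψ) := by
  classical
  let ev : MonoidAlgebra ℂ (N ⋊[φ] H) →ₗ[ℂ] (H ⧸ K → ℂ) :=
    { toFun := fun x q => x.coeff (SemidirectProduct.inr q.out)
      map_add' := fun x y => by ext; simp
      map_smul' := fun r x => by ext; simp }
  refine LinearIndependent.of_comp ev ?_
  have hc : (Nat.card N : ℂ)⁻¹ * (Nat.card K : ℂ)⁻¹ ≠ 0 :=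
    mul_ne_zero (by simp) (by simpa using Nat.card_pos.ne')
  suffices h : (ev ∘ fun q : H ⧸ K => MonoidAlgebra.single (SemidirectProduct.inr q.out) 1 *
      (vChar φ χ * uChar φ K ψ)) =
      fun q => Pi.single q ((Nat.card N : ℂ)⁻¹ * (Nat.card K : ℂ)⁻¹) by
    rw [h]
    exact Pi.linearIndependent_single_of_ne_zero fun _ => hc
  ext q q'
  simp only [Function.comp_apply, ev, LinearMap.coe_mk, AddHom.coe_mk,
    MonoidAlgebra.coeff_single_mul_apply, one_mul, ← map_inv, ← map_mul,
    coeff_vChar_mul_uChar_inr]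
  have hmem : q.out⁻¹ * q'.out ∈ K ↔ q = q' := by
    rw [← QuotientGroup.eq, QuotientGroup.out_eq', QuotientGroup.out_eq']
  by_cases hq : q = q'
  · subst hq
    have h1 : ψ ⟨1, K.one_mem⟩ = 1 := map_one ψ
    simp [h1]
  · rw [dif_neg (hmem.not.mpr hq), Pi.single_eq_of_ne (Ne.symm hq), mul_zero]

lemma range_mulRight_vChar_mul_uChar [Fintype N] [Finite H] (χ : N →* ℂˣ) (ψ : charStab φ χ →* ℂˣ) :
    LinearMap.range (LinearMap.mulRight ℂ (vChar φ χ * uChar φ (charStab φ χ) ψ)) =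
      Submodule.span ℂ (Set.range fun q : H ⧸ charStab φ χ =>
        MonoidAlgebra.single (SemidirectProduct.inr q.out) 1 *
          (vChar φ χ * uChar φ (charStab φ χ) ψ)) := by
  set e := vChar φ χ * uChar φ (charStab φ χ) ψ with he
  apply le_antisymm
  · rintro _ ⟨x, rfl⟩
    rw [LinearMap.mulRight_apply]
    induction x using MonoidAlgebra.induction_linear with
    | zero => simp
    | add x y hx hy => rw [add_mul]; exact add_mem hx hy
    | single g r =>
      obtain ⟨k, hk⟩ := QuotientGroup.mk_out_eq_mul (charStab φ χ) g.right
      have hg : g = SemidirectProduct.inr (g.right : H ⧸ charStab φ χ).out *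
          (SemidirectProduct.inr ((k⁻¹ : charStab φ χ) : H) *
            SemidirectProduct.inl (φ g.right⁻¹ g.left)) := by
        rw [hk, ← mul_assoc, ← map_mul]
        simp [SemidirectProduct.ext_iff]
      have hs : MonoidAlgebra.single g r = r •
          ((MonoidAlgebra.single (SemidirectProduct.inr (g.right : H ⧸ charStab φ χ).out) 1 :
            MonoidAlgebra ℂ (N ⋊[φ] H)) *
          (MonoidAlgebra.single (SemidirectProduct.inr ((k⁻¹ : charStab φ χ) : H)) 1 *
            MonoidAlgebra.single (SemidirectProduct.inl (φ g.right⁻¹ g.left)) 1)) := by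
        rw [MonoidAlgebra.single_mul_single, MonoidAlgebra.single_mul_single, ← hg]
        simp
      have hl (n : N) : MonoidAlgebra.single (SemidirectProduct.inl n) 1 * e = (χ n : ℂ) • e := by
        rw [he, ← mul_assoc, single_inl_mul_vChar, smul_mul_assoc]
      rw [hs, smul_mul_assoc, mul_assoc, mul_assoc, hl, mul_smul_comm,
        single_inr_mul_vChar_mul_uChar, mul_smul_comm, mul_smul_comm]
      exact Submodule.smul_mem _ _ (Submodule.smul_mem _ _ (Submodule.smul_mem _ _
        (Submodule.subset_span ⟨_, rfl⟩)))
  · rw [Submodule.span_le]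
    rintro _ ⟨q, rfl⟩
    exact ⟨_, rfl⟩

lemma card_range_charAct (χ : N →* ℂˣ) :
    Nat.card (Set.range fun h : H => charAct φ h χ) = (charStab φ χ).index := by
  let _ : MulAction H (N →* ℂˣ) :=
    { smul := charAct φ
      one_smul := charAct_one φ
      mul_smul := charAct_mul φ }
  exact (MulAction.index_stabilizer H χ).symm

end

/-- the left ideal `ℂ[G] * (v_χ u_ψ)` has ℂ-dimension equal to the size
of the orbit `O_χ` of `χ`, which is the index `[H : H_χ]` of the stabilizer of `χ`. -/
theorem finrank_left_ideal_vChar_uChar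
    (N H : Type*) [CommGroup N] [Fintype N] [CommGroup H] [Fintype H]
    (φ : H →* MulAut N) (χ : N →* ℂˣ) (ψ : (charStab φ χ) →* ℂˣ) :
    Module.finrank ℂ
        ↥(LinearMap.range (LinearMap.mulRight ℂ (vChar φ χ * uChar φ (charStab φ χ) ψ))) =
      Nat.card (Set.range (fun h : H => charAct φ h χ)) ∧
    Nat.card (Set.range (fun h : H => charAct φ h χ)) = (charStab φ χ).index := by
  classical
  refine ⟨?_, card_range_charAct φ χ⟩
  cases nonempty_fintype (H ⧸ charStab φ χ)
  rw [card_range_charAct, range_mulRight_vChar_mul_uChar,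
    finrank_span_eq_card (linearIndependent_single_out_mul_vChar_mul_uChar φ χ _ ψ),
    Subgroup.index, Nat.card_eq_fintype_card]
end
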